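/- arXiv:2001.09539 — 2 statements merged into one kernel-verified Lean document; each statement's English description precedes it below -/
import Mathlib

section
/- Let g be a Lie algebra over ℂ and let D be a derivation of g. Define g⁺ (respectively g⁰, g⁻) as the supremum, as a submodule of g, of the generalized eigenspaces of D for all α ∈ ℂ with Re α > 0 (respectively Re α = 0, Re α < 0). Then each of g⁺, g⁰ and g⁻ is closed under the Lie bracket, i.e. each is a Lie subalgebra of g. -/
open Module.End in
theorem Module.End.mem_maxGenEigenspace_of_sub_smul_apply_mem {R M : Type*} [CommRing R]
    [AddCommGroup M] [Module R M] {f : Module.End R M} {μ : R} {v : M}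
    (h : (f - μ • (1 : Module.End R M)) v ∈ f.maxGenEigenspace μ) :
    v ∈ f.maxGenEigenspace μ := by
  obtain ⟨m, hm⟩ := (mem_maxGenEigenspace _ _ _).1 h
  exact (mem_maxGenEigenspace _ _ _).2 ⟨m + 1, by rwa [pow_succ, Module.End.mul_apply]⟩

theorem LieDerivation.sub_smul_apply_lie {R L : Type*} [CommRing R] [LieRing L] [LieAlgebra R L]
    (D : LieDerivation R L L) (a b : R) (x y : L) :
    (D.toLinearMap - (a + b) • (1 : Module.End R L)) ⁅x, y⁆ =
      ⁅x, (D.toLinearMap - b • (1 : Module.End R L)) y⁆ +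
        ⁅(D.toLinearMap - a • (1 : Module.End R L)) x, y⁆ := by
  have h : D.toLinearMap ⁅x, y⁆ = ⁅x, D.toLinearMap y⁆ + ⁅D.toLinearMap x, y⁆ :=
    D.apply_lie_eq_add x y
  simp only [LinearMap.sub_apply, LinearMap.smul_apply, Module.End.one_apply, h, lie_sub, sub_lie,
    lie_smul, smul_lie, add_smul, LinearMap.add_apply]
  abel

/-- The generalized eigenspaces of a derivation are graded by the bracket. -/
theorem LieDerivation.lie_mem_maxGenEigenspace {R L : Type*} [CommRing R] [LieRing L]
    [LieAlgebra R L] (D : LieDerivation R L L) {a b : R} {x y : L}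
    (hx : x ∈ Module.End.maxGenEigenspace D.toLinearMap a)
    (hy : y ∈ Module.End.maxGenEigenspace D.toLinearMap b) :
    ⁅x, y⁆ ∈ Module.End.maxGenEigenspace D.toLinearMap (a + b) := by
  obtain ⟨k, hk⟩ := (Module.End.mem_maxGenEigenspace _ _ _).1 hx
  obtain ⟨l, hl⟩ := (Module.End.mem_maxGenEigenspace _ _ _).1 hy
  clear hx hy
  induction k generalizing x y l with
  | zero => simp [show x = 0 by simpa using hk]
  | succ k ihk =>
    induction l generalizing y with
    | zero => simp [show y = 0 by simpa using hl]
    | succ l ihl =>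
      apply Module.End.mem_maxGenEigenspace_of_sub_smul_apply_mem
      rw [D.sub_smul_apply_lie]
      refine add_mem (ihl ?_) (ihk ?_ (l + 1) hl)
      · rwa [pow_succ, Module.End.mul_apply] at hl
      · rwa [pow_succ, Module.End.mul_apply] at hk

theorem LieDerivation.lie_mem_iSup_maxGenEigenspace {R L : Type*} [CommRing R] [LieRing L]
    [LieAlgebra R L] (D : LieDerivation R L L) {s : Set R}
    (hs : ∀ a ∈ s, ∀ b ∈ s, a + b ∈ s) {x y : L}
    (hx : x ∈ ⨆ α ∈ s, Module.End.maxGenEigenspace D.toLinearMap α)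
    (hy : y ∈ ⨆ α ∈ s, Module.End.maxGenEigenspace D.toLinearMap α) :
    ⁅x, y⁆ ∈ ⨆ α ∈ s, Module.End.maxGenEigenspace D.toLinearMap α := by
  rw [iSup_subtype'] at hx hy
  induction hx using Submodule.iSup_induction' with
  | zero => simp
  | add x₁ x₂ _ _ h₁ h₂ => simpa only [add_lie] using add_mem h₁ h₂
  | mem a x hx =>
    induction hy using Submodule.iSup_induction' with
    | zero => simp
    | add y₁ y₂ _ _ h₁ h₂ => simpa only [lie_add] using add_mem h₁ h₂
    | mem b y hy =>
      exact Submodule.mem_iSup_of_mem _ (Submodule.mem_iSup_of_mem (hs a a.2 b b.2)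
        (D.lie_mem_maxGenEigenspace hx hy))

/-- For a derivation `D` of a complex Lie algebra `g`, the suprema of the generalized
eigenspaces of `D` over eigenvalues with positive (resp. zero, negative) real part are
closed under the Lie bracket, i.e. they are Lie subalgebras. -/
theorem sup_maxGenEigenspace_lie_closed {g : Type*} [LieRing g] [LieAlgebra ℂ g]
    (D : LieDerivation ℂ g g) (gplus gzero gminus : Submodule ℂ g)
    (hplus : gplus = ⨆ α ∈ {α : ℂ | 0 < α.re}, Module.End.maxGenEigenspace D.toLinearMap α)
    (hzero : gzero = ⨆ α ∈ {α : ℂ | α.re = 0}, Module.End.maxGenEigenspace D.toLinearMap α)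
    (hminus : gminus = ⨆ α ∈ {α : ℂ | α.re < 0}, Module.End.maxGenEigenspace D.toLinearMap α) :
    (∀ x ∈ gplus, ∀ y ∈ gplus, ⁅x, y⁆ ∈ gplus) ∧
    (∀ x ∈ gzero, ∀ y ∈ gzero, ⁅x, y⁆ ∈ gzero) ∧
    (∀ x ∈ gminus, ∀ y ∈ gminus, ⁅x, y⁆ ∈ gminus) := by
  subst hplus hzero hminus
  refine ⟨fun x hx y hy ↦ D.lie_mem_iSup_maxGenEigenspace ?_ hx hy,
    fun x hx y hy ↦ D.lie_mem_iSup_maxGenEigenspace ?_ hx hy,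
    fun x hx y hy ↦ D.lie_mem_iSup_maxGenEigenspace ?_ hx hy⟩ <;>
  · intro a ha b hb
    simp only [Set.mem_ofPred_eq, Complex.add_re] at *
    linarith
end

section
/- Let λ > 0, M ≥ 0 and τ ≥ 0. Let u : ℝ → ℝ be continuous with |u(t)| ≤ M for all t, and let x : ℝ → ℝ be a function having derivative λ·x(t) + u(t) at every t ∈ ℝ, with x(τ) = 0. Then for every t ∈ [0, τ], |x(t)| ≤ (M/λ)·(1 − e^{λ(t−τ)}); in particular, if M > 0 then |x(t)| < M/λ for every t ∈ [0, τ]. -/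
/-- If `ẋ = λ x + u` with `u ≤ M` and `x(τ) = 0`, then `x` is bounded below before time `τ`. -/
theorem neg_le_of_hasDerivAt_linear_of_le {lam M τ : ℝ} (hlam : 0 < lam) {u x : ℝ → ℝ}
    (huM : ∀ t, u t ≤ M) (hx : ∀ t, HasDerivAt x (lam * x t + u t) t) (hxτ : x τ = 0)
    {t : ℝ} (ht : t ≤ τ) : -(M / lam * (1 - Real.exp (lam * (t - τ)))) ≤ x t := by
  have hderiv (s : ℝ) : HasDerivAt (fun s => Real.exp (lam * (t - s)) * (x s + M / lam))
      (Real.exp (lam * (t - s)) * (u s - M)) s := by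
    have hexp : HasDerivAt (fun s => Real.exp (lam * (t - s)))
        (Real.exp (lam * (t - s)) * (lam * -1)) s :=
      (((hasDerivAt_id s).const_sub t).const_mul lam).exp
    refine (hexp.mul ((hx s).add_const (M / lam))).congr_deriv ?_
    field_simp
    ring
  have hanti := antitone_of_hasDerivAt_nonpos hderiv fun s =>
    mul_nonpos_of_nonneg_of_nonpos (Real.exp_pos _).le (sub_nonpos.2 (huM s))
  have h := hanti ht
  simp only [hxτ, sub_self, mul_zero, Real.exp_zero, one_mul, zero_add] at h
  linarith

/-- If `ẋ = λ x + u` with `λ > 0`, `|u| ≤ M` and `x(τ) = 0`, then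
`|x t| ≤ (M/λ)(1 - e^{λ(t-τ)})` on `[0, τ]`; in particular `|x t| < M/λ` there when `M > 0`. -/
theorem scalar_ode_bound (lam M τ : ℝ) (hlam : 0 < lam) (hM : 0 ≤ M) (hτ : 0 ≤ τ)
    (u : ℝ → ℝ) (hu : Continuous u) (huM : ∀ t : ℝ, |u t| ≤ M)
    (x : ℝ → ℝ) (hx : ∀ t : ℝ, HasDerivAt x (lam * x t + u t) t) (hxτ : x τ = 0) :
    (∀ t ∈ Set.Icc (0:ℝ) τ, |x t| ≤ M / lam * (1 - Real.exp (lam * (t - τ)))) ∧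
    (0 < M → ∀ t ∈ Set.Icc (0:ℝ) τ, |x t| < M / lam) := by
  have hbound : ∀ t ∈ Set.Icc (0:ℝ) τ,
      |x t| ≤ M / lam * (1 - Real.exp (lam * (t - τ))) := by
    intro t ht
    have hlower := neg_le_of_hasDerivAt_linear_of_le hlam
      (fun s => (abs_le.1 (huM s)).2) hx hxτ ht.2
    have hupper := neg_le_of_hasDerivAt_linear_of_le (u := -u) (x := -x) hlam
      (fun s => neg_le.1 (abs_le.1 (huM s)).1)
      (fun s => (hx s).neg.congr_deriv (by simp only [Pi.neg_apply]; ring))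
      (by simp [hxτ]) ht.2
    exact abs_le.2 ⟨hlower, neg_le_neg_iff.1 hupper⟩
  refine ⟨hbound, fun hMpos t ht => (hbound t ht).trans_lt ?_⟩
  exact mul_lt_of_lt_one_right (div_pos hMpos hlam) (sub_lt_self 1 (Real.exp_pos _))
end
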